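/- Let τ and t̃ be nonzero vectors in ℂ². Then the 2×2 matrix u = (|τ⟩[t̃| − |τ]⟨t̃|) / √(⟨τ|τ⟩·⟨t̃|t̃⟩) is unitary and has determinant 1, i.e. u ∈ SU(2). (Here |τ⟩[t̃| denotes the outer product of the column vector |τ⟩ with the row vector [t̃|, and |τ]⟨t̃| the outer product of the column vector |τ] with the row vector ⟨t̃|.) -/

import Mathlib

open Matrix

noncomputable section

/-- `⟨x|`: the conjugate-transpose row vector `(x̄₀, x̄₁)`. -/
def braC (x : Fin 2 → ℂ) : Fin 2 → ℂ := fun i => star (x i)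

/-- `|x]`: the column vector `(−x̄₁, x̄₀)`. -/
def ketS (x : Fin 2 → ℂ) : Fin 2 → ℂ := ![-(star (x 1)), star (x 0)]

/-- `[x|`: the row vector `(−x₁, x₀)`. -/
def braS (x : Fin 2 → ℂ) : Fin 2 → ℂ := ![-(x 1), x 0]

/-- `⟨x|y⟩ = x̄₀y₀ + x̄₁y₁`. -/
def bk (x y : Fin 2 → ℂ) : ℂ := star (x 0) * y 0 + star (x 1) * y 1

/-- `[x|y⟩ = x₀y₁ − x₁y₀`. -/
def sk (x y : Fin 2 → ℂ) : ℂ := x 0 * y 1 - x 1 * y 0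

/-- `⟨x|y] = x̄₁ȳ₀ − x̄₀ȳ₁`. -/
def bs (x y : Fin 2 → ℂ) : ℂ := star (x 1) * star (y 0) - star (x 0) * star (y 1)

/-- `[x|y] = x₀ȳ₀ + x₁ȳ₁`. -/
def ss (x y : Fin 2 → ℂ) : ℂ := x 0 * star (y 0) + x 1 * star (y 1)

end

open ComplexConjugate in
theorem vecMulVec_braS_sub_vecMulVec_braC (x y : Fin 2 → ℂ) :
    vecMulVec x (braS y) - vecMulVec (ketS x) (braC y) =
      !![conj (x 1) * conj (y 0) - x 0 * y 1, x 0 * y 0 + conj (x 1) * conj (y 1);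
        -(conj (x 0) * conj (y 0) + x 1 * y 1), x 1 * y 0 - conj (x 0) * conj (y 1)] := by
  ext i j
  fin_cases i <;> fin_cases j <;> simp [-cons_vecMulVec, -vecMulVec_cons, vecMulVec_apply, braS, braC, ketS] <;> ring

theorem det_vecMulVec_braS_sub_vecMulVec_braC (x y : Fin 2 → ℂ) :
    (vecMulVec x (braS y) - vecMulVec (ketS x) (braC y)).det =
      (((Complex.normSq (x 0) + Complex.normSq (x 1)) *
        (Complex.normSq (y 0) + Complex.normSq (y 1)) : ℝ) : ℂ) := by
  rw [vecMulVec_braS_sub_vecMulVec_braC, det_fin_two_of]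
  push_cast [Complex.normSq_eq_conj_mul_self]
  ring

theorem star_vecMulVec_braS_sub_vecMulVec_braC (x y : Fin 2 → ℂ) :
    star (vecMulVec x (braS y) - vecMulVec (ketS x) (braC y)) =
      (vecMulVec x (braS y) - vecMulVec (ketS x) (braC y)).adjugate := by
  rw [vecMulVec_braS_sub_vecMulVec_braC, adjugate_fin_two_of]
  ext i j
  fin_cases i <;> fin_cases j <;> simp [star_apply]

theorem normSq_add_normSq_pos {x : Fin 2 → ℂ} (hx : x ≠ 0) :
    0 < Complex.normSq (x 0) + Complex.normSq (x 1) := by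
  obtain ⟨i, hi⟩ := Function.ne_iff.mp hx
  have h := Complex.normSq_pos.mpr hi
  fin_cases i
  · exact add_pos_of_pos_of_nonneg h (Complex.normSq_nonneg _)
  · exact add_pos_of_nonneg_of_pos (Complex.normSq_nonneg _) h

/-- A `2 × 2` matrix whose adjoint is its adjugate and whose determinant is a positive real
becomes special unitary after division by the square root of its determinant. -/
theorem inv_sqrt_smul_mem_unitaryGroup_and_det_eq_one {M : Matrix (Fin 2) (Fin 2) ℂ} {r : ℝ}
    (hr : 0 < r) (hdet : M.det = r) (hstar : star M = M.adjugate) :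
    ((Real.sqrt r : ℂ))⁻¹ • M ∈ unitaryGroup (Fin 2) ℂ ∧ (((Real.sqrt r : ℂ))⁻¹ • M).det = 1 := by
  have hr' : (r : ℂ) ≠ 0 := Complex.ofReal_ne_zero.mpr hr.ne'
  have hsq : ((Real.sqrt r : ℂ))⁻¹ * ((Real.sqrt r : ℂ))⁻¹ * r = 1 := by
    rw [← mul_inv, ← Complex.ofReal_mul, Real.mul_self_sqrt hr.le, inv_mul_cancel₀ hr']
  constructor
  · have hreal : star ((Real.sqrt r : ℂ))⁻¹ = ((Real.sqrt r : ℂ))⁻¹ := by simp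
    rw [mem_unitaryGroup_iff, star_smul, hreal, hstar, smul_mul_smul_comm, mul_adjugate, hdet,
      smul_smul, hsq, one_smul]
  · rw [det_smul, Fintype.card_fin, hdet, sq, hsq]

/-- For nonzero `τ, t̃ ∈ ℂ²`, the matrix
`u = (|τ⟩[t̃| − |τ]⟨t̃|)/√(⟨τ|τ⟩·⟨t̃|t̃⟩)` belongs to `SU(2)`:
it is unitary and has determinant 1. -/
theorem holonomy_from_spinors_mem_SU2 (τ tt : Fin 2 → ℂ) (hτ : τ ≠ 0) (htt : tt ≠ 0) :
    ((Real.sqrt ((Complex.normSq (τ 0) + Complex.normSq (τ 1)) *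
        (Complex.normSq (tt 0) + Complex.normSq (tt 1))) : ℂ))⁻¹ •
      (Matrix.vecMulVec τ (braS tt) - Matrix.vecMulVec (ketS τ) (braC tt))
        ∈ Matrix.unitaryGroup (Fin 2) ℂ ∧
    (((Real.sqrt ((Complex.normSq (τ 0) + Complex.normSq (τ 1)) *
        (Complex.normSq (tt 0) + Complex.normSq (tt 1))) : ℂ))⁻¹ •
      (Matrix.vecMulVec τ (braS tt) - Matrix.vecMulVec (ketS τ) (braC tt))).det = 1 := by
  exact inv_sqrt_smul_mem_unitaryGroup_and_det_eq_one
    (mul_pos (normSq_add_normSq_pos hτ) (normSq_add_normSq_pos htt))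
    (det_vecMulVec_braS_sub_vecMulVec_braC τ tt) (star_vecMulVec_braS_sub_vecMulVec_braC τ tt)
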